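/- arXiv:1304.4927 — 3 statements merged into one kernel-verified Lean document; each statement's English description precedes it below -/
import Mathlib

section
/- Let R be a finite ring with identity 1 ≠ 0 and let x ∈ R. Then the association class of x, i.e. the set {y ∈ R : Ry = Rx} of all elements generating the same principal left ideal as x, equals the orbit R^× x = {ux : u ∈ R^×} of x under left multiplication by units of R. -/
/-- If `x` and `y` generate the same left ideal, then every left ideal `N` contains as many
solutions `u` of `u * x = y` as of `u * x = x`. -/
theorem card_mem_mul_eq_of_span_eq {R : Type*} [Ring R] [Finite R] {x y : R}
    (h : Ideal.span {y} = Ideal.span {x}) (N : Ideal R) :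
    Nat.card {u : R // u ∈ N ∧ u * x = y} = Nat.card {u : R // u ∈ N ∧ u * x = x} := by
  obtain ⟨a, ha⟩ := Ideal.mem_span_singleton'.1 (h ▸ Ideal.mem_span_singleton_self y)
  obtain ⟨b, hb⟩ := Ideal.mem_span_singleton'.1 (h ▸ Ideal.mem_span_singleton_self x)
  by_cases hv : ∃ v ∈ N, v * x = y
  · obtain ⟨v, hvN, hv⟩ := hv
    have hbv : b * v ∈ N := N.mul_mem_left b hvN
    refine Nat.card_congr ((Equiv.addRight (b * v - v)).subtypeEquiv fun u => ?_)
    have hN : u + (b * v - v) ∈ N ↔ u ∈ N := N.add_mem_iff_left (N.sub_mem hbv hvN)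
    rw [Equiv.coe_addRight, hN, add_mul, sub_mul, mul_assoc, hv, hb, add_sub_left_comm,
      add_eq_left, sub_eq_zero]
  · have hw : ¬ ∃ w ∈ N, w * x = x := fun ⟨w, hwN, hw⟩ =>
      hv ⟨a * w, N.mul_mem_left a hwN, by rw [mul_assoc, hw, ha]⟩
    have : IsEmpty {u : R // u ∈ N ∧ u * x = y} := ⟨fun u => hv ⟨u, u.2⟩⟩
    have : IsEmpty {u : R // u ∈ N ∧ u * x = x} := ⟨fun u => hw ⟨u, u.2⟩⟩
    simp

open Finset Classical in
/-- The solutions of `u * x = y` in `N`, sorted by the left ideal they generate. -/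
theorem card_mem_mul_eq_add_sum {R : Type*} [Ring R] [Finite R] [Fintype (Ideal R)] (x y : R)
    (N : Ideal R) :
    Nat.card {u : R // u ∈ N ∧ u * x = y} =
      Nat.card {u : R // Ideal.span {u} = N ∧ u * x = y} +
        ∑ I with I < N, Nat.card {u : R // Ideal.span {u} = I ∧ u * x = y} := by
  have := Fintype.ofFinite R
  have key := card_eq_sum_card_fiberwise (s := {u : R | u ∈ N ∧ u * x = y})
    (t := insert N (univ.filter (· < N))) (f := fun u => Ideal.span {u}) (by
      intro u hu
      have hu' : Ideal.span {u} ≤ N := by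
        rw [Ideal.span_singleton_le_iff_mem]
        simp_all
      simpa using hu'.eq_or_lt)
  rw [sum_insert (by simp)] at key
  have fiber (I : Ideal R) (hI : I ≤ N) :
      #{u ∈ ({u : R | u ∈ N ∧ u * x = y} : Finset R) | Ideal.span {u} = I} =
        Nat.card {u : R // Ideal.span {u} = I ∧ u * x = y} := by
    rw [Nat.card_eq_fintype_card, Fintype.card_subtype, filter_filter]
    congr 1
    ext u
    simp only [mem_filter, mem_univ, true_and]
    constructor
    · tauto
    · rintro ⟨rfl, hu⟩
      exact ⟨⟨hI (Ideal.mem_span_singleton_self u), hu⟩, rfl⟩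
  rw [Nat.card_eq_fintype_card, Fintype.card_subtype, key, fiber N le_rfl]
  congr 1
  exact sum_congr rfl fun I hI => fiber I (by simpa using (mem_filter.1 hI).2.le)

/-- If `x` and `y` generate the same left ideal, then every left ideal `N` has as many
generators `u` with `u * x = y` as with `u * x = x`. -/
theorem card_span_eq_mul_eq_of_span_eq {R : Type*} [Ring R] [Finite R] {x y : R}
    (h : Ideal.span {y} = Ideal.span {x}) (N : Ideal R) :
    Nat.card {u : R // Ideal.span {u} = N ∧ u * x = y} =
      Nat.card {u : R // Ideal.span {u} = N ∧ u * x = x} := by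
  classical
  have : Finite (Ideal R) := Finite.of_injective _ (SetLike.coe_injective (A := Ideal R))
  have := Fintype.ofFinite (Ideal R)
  induction N using WellFoundedLT.induction with
  | ind N ih =>
    have hN := card_mem_mul_eq_of_span_eq h N
    rw [card_mem_mul_eq_add_sum, card_mem_mul_eq_add_sum,
      Finset.sum_congr rfl fun I hI => ih I (Finset.mem_filter.1 hI).2] at hN
    exact Nat.add_right_cancel hN


/-- In a finite ring `R` with `1 ≠ 0`, the association class of `x`,
i.e. the set of elements generating the same principal left ideal as `x`,
equals the orbit `R^× x` of `x` under left multiplication by units. -/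
theorem association_class_eq_unit_orbit (R : Type*) [Ring R] [Fintype R] [Nontrivial R]
    (x : R) :
    {y : R | Ideal.span {y} = Ideal.span {x}} =
      Set.range (fun u : Rˣ => (u : R) * x) := by
  ext y
  simp only [Set.mem_ofPred_eq, Set.mem_range]
  constructor
  · intro h
    have hne : Nonempty {u : R // Ideal.span {u} = ⊤ ∧ u * x = x} :=
      ⟨1, Ideal.span_singleton_one, one_mul x⟩
    have hpos := Nat.card_pos (α := {u : R // Ideal.span {u} = ⊤ ∧ u * x = x})
    rw [← card_span_eq_mul_eq_of_span_eq h] at hpos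
    obtain ⟨⟨u, hu, hux⟩⟩ := (Nat.card_pos_iff.1 hpos).1
    obtain ⟨v, hv⟩ := Ideal.mem_span_singleton'.1 (hu ▸ Submodule.mem_top : (1 : R) ∈ _)
    exact ⟨⟨u, v, mul_eq_one_symm hv, hv⟩, hux⟩
  · rintro ⟨u, rfl⟩
    exact Ideal.span_singleton_mul_left_unit u.isUnit x
end

section
/- Let R be a finite ring with identity and let w be a left homogeneous weight on R with average value λ. Then for every x ∈ R, w(x) = λ · (1 − μ(0, Rx)/φ(x)), where μ(0, Rx) is the value of the Möbius function of the poset of principal left ideals of R (ordered by inclusion) on the interval from the zero ideal to Rx, and φ(x) is the number of elements y ∈ R with Ry = Rx. -/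
/-- `w` is a left homogeneous weight on the ring `R` with average value `lam ≥ 0`:
`w 0 = 0`; (H1) `w x = w y` whenever `Rx = Ry`; and (H2) for every nonzero `x`,
`Σ_{y ∈ Rx} w y = lam ⬝ |Rx|`. -/
def IsHomogeneousWeight {R : Type*} [Ring R] (w : R → ℝ) (lam : ℝ) : Prop :=
  0 ≤ lam ∧ w 0 = 0 ∧
  (∀ x y : R, Ideal.span {x} = Ideal.span {y} → w x = w y) ∧
  (∀ x : R, x ≠ 0 →
    ∑ᶠ y ∈ ((Ideal.span {x} : Ideal R) : Set R), w y =
      lam * (Nat.card (Ideal.span {x} : Ideal R) : ℝ))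

/-- `μ` is the Möbius function of the partial order `α`. -/
def IsMobiusFunction {α : Type*} [PartialOrder α] (μ : α → α → ℤ) : Prop :=
  (∀ a : α, μ a a = 1) ∧
  (∀ a b : α, ¬ a ≤ b → μ a b = 0) ∧
  (∀ a b : α, a < b → ∑ᶠ c ∈ {c : α | a ≤ c ∧ c ≤ b}, μ a c = 0)

open Classical in
/-- A function on a finite poset all of whose down-set sums vanish is zero. -/
theorem eq_zero_of_sum_le_eq_zero {α M : Type*} [PartialOrder α] [Fintype α] [AddCommMonoid M]
    {f : α → M} (h : ∀ b, ∑ a with a ≤ b, f a = 0) (b : α) : f b = 0 := by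
  induction b using WellFoundedLT.induction with
  | ind b ih =>
    rw [← h b]
    symm
    refine Finset.sum_eq_single b (fun a ha hab ↦ ih a ?_) (by simp)
    exact lt_of_le_of_ne (Finset.mem_filter.mp ha).2 hab

open Classical in
/-- The sum of the Möbius function along a down-set of a poset with least element. -/
theorem IsMobiusFunction.sum_le_eq_ite {α : Type*} [PartialOrder α] [Fintype α] {μ : α → α → ℤ}
    (hμ : IsMobiusFunction μ) {o : α} (ho : ∀ a, o ≤ a) (b : α) :
    ∑ a with a ≤ b, μ o a = if b = o then 1 else 0 := by
  split_ifs with hb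
  · subst hb
    rw [Finset.sum_eq_single b]
    · exact hμ.1 b
    · exact fun a ha hab ↦ absurd (le_antisymm (Finset.mem_filter.mp ha).2 (ho a)) hab
    · simp
  · rw [← hμ.2.2 o b (lt_of_le_of_ne (ho b) (Ne.symm hb)), finsum_mem_eq_toFinset_sum]
    exact Finset.sum_congr (by ext; simp [ho]) fun _ _ ↦ rfl

open Classical in
/-- The deviations of a homogeneous weight from its average sum to zero over every nonzero
principal left ideal. -/
theorem IsHomogeneousWeight.sum_sub_eq_ite {R : Type*} [Ring R] [Fintype R] {w : R → ℝ} {lam : ℝ}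
    (hw : IsHomogeneousWeight w lam) (x : R) :
    ∑ y with Ideal.span {y} ≤ Ideal.span {x}, (w y - lam) = if x = 0 then -lam else 0 := by
  have hset : (Finset.univ.filter fun y : R ↦ Ideal.span {y} ≤ Ideal.span {x}) =
      ((Ideal.span {x} : Ideal R) : Set R).toFinset := by
    ext y
    simp
  rw [hset]
  split_ifs with hx
  · subst hx
    rw [Finset.sum_eq_single 0] <;> simp +contextual [hw.2.1]
  · have h := hw.2.2.2 x hx
    rw [finsum_mem_eq_toFinset_sum, Nat.card_eq_fintype_card] at h
    rw [Finset.sum_sub_distrib, h, Finset.sum_const, nsmul_eq_mul, Set.toFinset_card, mul_comm]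
    exact sub_self _

/-- (Greferath–Schmidt formula) If `w` is a left homogeneous weight with
average value `λ` on a finite ring `R`, then `w x = λ (1 - μ(0, Rx) / φ(x))`, where
`μ` is the Möbius function of the poset of principal left ideals and `φ(x)` is the
number of elements generating `Rx`. -/
theorem homogeneous_weight_eq_mobius_formula (R : Type*) [Ring R] [Fintype R]
    (w : R → ℝ) (lam : ℝ) (hw : IsHomogeneousWeight w lam)
    (μ : {J : Ideal R // ∃ y : R, J = Ideal.span {y}} →
         {J : Ideal R // ∃ y : R, J = Ideal.span {y}} → ℤ)
    (hμ : IsMobiusFunction μ) (x : R) :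
    w x = lam * (1 -
      (μ ⟨Ideal.span {(0 : R)}, 0, rfl⟩ ⟨Ideal.span {x}, x, rfl⟩ : ℝ) /
        (Nat.card {y : R // Ideal.span {y} = Ideal.span {x}} : ℝ)) := by
  classical
  let P := {J : Ideal R // ∃ y : R, J = Ideal.span {y}}
  let gen : R → P := fun y ↦ ⟨Ideal.span {y}, y, rfl⟩
  have hgen : ∀ y z, gen y = gen z ↔ (Ideal.span {y} : Ideal R) = Ideal.span {z} :=
    fun y z ↦ Subtype.ext_iff
  have : Finite P := Finite.of_surjective gen fun ⟨_, y, hy⟩ ↦ ⟨y, Subtype.ext hy.symm⟩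
  have := Fintype.ofFinite P
  have ho : ∀ J : P, gen 0 ≤ J := fun J ↦
    (Ideal.span_singleton_le_iff_mem _).mpr J.1.zero_mem
  have key := eq_zero_of_sum_le_eq_zero (α := P)
    (f := fun J ↦ ∑ y with gen y = J, (w y - lam) + lam * (μ (gen 0) J : ℝ)) (by
      rintro ⟨_, z, rfl⟩
      change ∑ J with J ≤ gen z, _ = _
      have hfib : ∑ J with J ≤ gen z, ∑ y with gen y = J, (w y - lam) =
          ∑ y with Ideal.span {y} ≤ Ideal.span {z}, (w y - lam) := by
        rw [← Finset.sum_fiberwise_of_maps_to (g := gen)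
          (t := Finset.univ.filter fun J ↦ J ≤ gen z)]
        · refine Finset.sum_congr rfl fun J hJ ↦ Finset.sum_congr ?_ fun _ _ ↦ rfl
          ext y
          simp only [Finset.mem_filter, Finset.mem_univ, true_and] at hJ ⊢
          exact ⟨fun h ↦ ⟨show gen y ≤ gen z from h ▸ hJ, h⟩, And.right⟩
        · intro y hy
          exact Finset.mem_filter.mpr ⟨Finset.mem_univ _, (Finset.mem_filter.mp hy).2⟩
      have hz : gen z = gen 0 ↔ z = 0 := by simp [hgen]
      rw [Finset.sum_add_distrib, hfib, hw.sum_sub_eq_ite, ← Finset.mul_sum, ← Int.cast_sum,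
        hμ.sum_le_eq_ite ho]
      simp only [hz]
      split_ifs <;> simp) (gen x)
  have hcard : Nat.card {y : R // Ideal.span {y} = Ideal.span {x}} =
      (Finset.univ.filter fun y ↦ gen y = gen x).card := by
    rw [Nat.card_eq_fintype_card, Fintype.card_subtype]
    simp only [hgen]
  have hpos : (Nat.card {y : R // Ideal.span {y} = Ideal.span {x}} : ℝ) ≠ 0 := by
    have : Nonempty {y : R // Ideal.span {y} = Ideal.span {x}} := ⟨x, rfl⟩
    exact_mod_cast Nat.card_pos.ne'
  have hsum : ∑ y with gen y = gen x, (w y - lam) =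
      (Nat.card {y : R // Ideal.span {y} = Ideal.span {x}} : ℝ) * (w x - lam) := by
    rw [hcard, ← nsmul_eq_mul, ← Finset.sum_const]
    refine Finset.sum_congr rfl fun y hy ↦ ?_
    rw [hw.2.2.1 y x ((hgen y x).mp (Finset.mem_filter.mp hy).2)]
  rw [hsum] at key
  change w x = lam * (1 - (μ (gen 0) (gen x) : ℝ) / _)
  field_simp
  linarith
end

section
/- (Honold's formula) Let R be a finite ring with identity, χ a generating character of R, and w a left homogeneous weight on R with average value λ. Then for every x ∈ R, w(x) = λ · (1 − (1/|R^×|) · Σ_{u ∈ R^×} χ(ux)), where R^× is the group of units of R (equality of complex numbers, with w(x) and λ regarded as complex). -/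
/-- `χ` is a generating character of the ring `R`. -/
def IsGeneratingCharacter {R : Type*} [Ring R] (χ : AddChar R ℂ) : Prop :=
  ∀ I : Ideal R, (∃ x : R, I = Ideal.span {x}) → I ≠ ⊥ → ∃ y ∈ I, χ y ≠ 1

open Finset in
open scoped Classical in
/-- The fibres of `u ↦ u * x` on a left ideal do not shrink when passing from `z` to `c * z`. -/
theorem card_filter_mul_eq_le {R : Type*} [Ring R] [Fintype R] (I : Ideal R) (x z c : R) :
    #{u : R | u ∈ I ∧ u * x = z} ≤ #{u : R | u ∈ I ∧ u * x = c * z} := by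
  by_cases h : ∃ u₀ ∈ I, u₀ * x = z
  · obtain ⟨u₀, hu₀, rfl⟩ := h
    refine card_le_card_of_injOn (fun u => u + (c * u₀ - u₀)) ?_ (add_left_injective _).injOn
    intro u hu
    simp only [coe_filter, mem_univ, true_and, Set.mem_ofPred_eq] at hu ⊢
    refine ⟨I.add_mem hu.1 (I.sub_mem (I.mul_mem_left c hu₀) hu₀), ?_⟩
    rw [add_mul, sub_mul, hu.2, mul_assoc, add_sub_cancel]
  · rw [filter_eq_empty_iff.2 fun u _ hu => h ⟨u, hu⟩]
    simp

open Finset in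
open scoped Classical in
/-- Gaschütz's lemma for principal left ideals: the number of generators `u` of a left ideal with
`u * x = z` is the same for any two `z` generating the same left ideal. -/
theorem card_generators_mul_eq {R : Type*} [Ring R] [Fintype R] (x : R) {z z' : R}
    (h : Ideal.span {z} = Ideal.span {z'}) (I : Ideal R) :
    #{u : R | Ideal.span {u} = I ∧ u * x = z} = #{u : R | Ideal.span {u} = I ∧ u * x = z'} := by
  have split (I : Ideal R) (z : R) : #{u : R | u ∈ I ∧ u * x = z} =
      #{u : R | Ideal.span {u} = I ∧ u * x = z} +
        ∑ J : Ideal R with J < I, #{u : R | Ideal.span {u} = J ∧ u * x = z} := by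
    have key : #{u : R | Ideal.span {u} < I ∧ u * x = z} =
        ∑ J : Ideal R with J < I, #{u : R | Ideal.span {u} = J ∧ u * x = z} := by
      rw [card_eq_sum_card_fiberwise (f := fun u : R => Ideal.span {u})
        (t := {J : Ideal R | J < I}) fun u hu => by simp_all]
      refine sum_congr rfl fun J hJ => congrArg card ?_
      ext u
      simp only [mem_filter, mem_univ, true_and] at hJ ⊢
      constructor
      · rintro ⟨⟨_, h⟩, rfl⟩
        exact ⟨rfl, h⟩
      · rintro ⟨rfl, h⟩
        exact ⟨⟨hJ, h⟩, rfl⟩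
    rw [← key, ← card_union_of_disjoint, ← filter_or]
    · refine congrArg card (filter_congr fun u _ => ?_)
      rw [← Ideal.span_singleton_le_iff_mem, le_iff_eq_or_lt, or_and_right]
    · rw [disjoint_filter]
      exact fun u _ h h' => h'.1.ne h.1
  have total (I : Ideal R) :
      #{u : R | u ∈ I ∧ u * x = z} = #{u : R | u ∈ I ∧ u * x = z'} := by
    obtain ⟨a, rfl⟩ := Ideal.mem_span_singleton'.1 (h ▸ Ideal.mem_span_singleton_self z)
    obtain ⟨b, hb⟩ := Ideal.mem_span_singleton'.1 (h ▸ Ideal.mem_span_singleton_self z')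
    refine le_antisymm ?_ (card_filter_mul_eq_le I x z' a)
    conv_rhs => rw [← hb]
    exact card_filter_mul_eq_le I x (a * z') b
  induction I using WellFoundedLT.induction with
  | ind I ih =>
    have hI := total I
    rw [split, split, sum_congr rfl fun J hJ => ih J (mem_filter.1 hJ).2] at hI
    exact Nat.add_right_cancel hI

/-- In a finite ring, generators of the same principal left ideal differ by a unit. -/
theorem exists_unit_mul_eq_of_span_eq {R : Type*} [Ring R] [Finite R] {x y : R}
    (h : Ideal.span {x} = Ideal.span {y}) : ∃ u : Rˣ, u * x = y := by
  classical
  have := Fintype.ofFinite R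
  have hpos : 0 < Finset.card {u : R | Ideal.span {u} = ⊤ ∧ u * x = x} :=
    Finset.card_pos.2 ⟨1, by simp⟩
  rw [card_generators_mul_eq x h] at hpos
  obtain ⟨u, hu⟩ := Finset.card_pos.1 hpos
  simp only [Finset.mem_filter, Finset.mem_univ, true_and] at hu
  obtain ⟨v, hv⟩ := Ideal.mem_span_singleton'.1 (hu.1 ▸ Submodule.mem_top : (1 : R) ∈ _)
  exact ⟨⟨u, v, mul_eq_one_symm hv, hv⟩, hu.2⟩

/-- A function on a finite ring that vanishes at `0`, depends only on the generated left ideal and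
sums to zero over every nonzero principal left ideal is zero. -/
theorem eq_zero_of_sum_span_eq_zero {R : Type*} [Ring R] [Fintype R] {f : R → ℂ} (h₀ : f 0 = 0)
    (h₁ : ∀ x y, Ideal.span {x} = Ideal.span {y} → f x = f y)
    (h₂ : ∀ x, x ≠ 0 → ∑ᶠ y ∈ ((Ideal.span {x} : Ideal R) : Set R), f y = 0) (x : R) :
    f x = 0 := by
  classical
  induction hI : Ideal.span {x} using WellFoundedLT.induction generalizing x with
  | ind I ih =>
    subst hI
    obtain rfl | hx := eq_or_ne x 0
    · exact h₀
    have hsum := h₂ x hx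
    rw [finsum_mem_eq_sum_of_inter_support_eq (t := {y : R | Ideal.span {y} = Ideal.span {x}}) f,
      Finset.sum_congr rfl fun y hy => h₁ y x (Finset.mem_filter.1 hy).2, Finset.sum_const,
      nsmul_eq_mul, mul_eq_zero, Nat.cast_eq_zero, Finset.card_eq_zero] at hsum
    · refine hsum.resolve_left (Finset.Nonempty.ne_empty ⟨x, by simp⟩)
    · ext y
      simp only [Set.mem_inter_iff, SetLike.mem_coe, Function.mem_support, Finset.coe_filter,
        Finset.mem_univ, true_and, Set.mem_ofPred_eq, and_congr_left_iff]
      intro hy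
      rw [← Ideal.span_singleton_le_iff_mem]
      exact ⟨fun hle => by_contra fun hne => hy (ih _ (lt_of_le_of_ne hle hne) y rfl), le_of_eq⟩

/-- A generating character, translated by a unit, sums to zero over nonzero principal left
ideals. -/
theorem IsGeneratingCharacter.sum_span_eq_zero {R : Type*} [Ring R] [Finite R] {χ : AddChar R ℂ}
    (hχ : IsGeneratingCharacter χ) {x : R} (hx : x ≠ 0) (u : Rˣ) :
    ∑ᶠ y ∈ ((Ideal.span {x} : Ideal R) : Set R), χ (u * y) = 0 := by
  obtain ⟨z, hz, hz1⟩ := hχ (Ideal.span {x}) ⟨x, rfl⟩ (by simpa using hx)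
  have hz' : ↑u⁻¹ * z ∈ Ideal.span {x} := Ideal.mul_mem_left _ _ hz
  refine eq_zero_of_mul_eq_self_left hz1 ?_
  rw [mul_finsum_mem]
  refine finsum_mem_eq_of_bijOn (· + ↑u⁻¹ * z)
    ⟨fun y hy => Ideal.add_mem _ hy hz', (add_left_injective _).injOn, fun y hy =>
      ⟨y - ↑u⁻¹ * z, Ideal.sub_mem _ hy hz', sub_add_cancel _ _⟩⟩ fun y _ => ?_
  rw [mul_add, Units.mul_inv_cancel_left, AddChar.map_add_eq_mul, mul_comm]

/-- Unit averages of a character depend only on the generated left ideal. -/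
theorem finsum_units_eq_of_span_eq {R : Type*} [Ring R] [Finite R] (χ : AddChar R ℂ) {x y : R}
    (h : Ideal.span {x} = Ideal.span {y}) :
    ∑ᶠ u : Rˣ, χ (u * x) = ∑ᶠ u : Rˣ, χ (u * y) := by
  obtain ⟨v, rfl⟩ := exists_unit_mul_eq_of_span_eq h
  rw [← finsum_comp_equiv (Equiv.mulRight v)]
  simp [mul_assoc]

/-- (Honold's formula) If `χ` is a generating character and `w` a left
homogeneous weight with average value `λ` on a finite ring `R`, then for every `x ∈ R`,
`w x = λ (1 - (1/|R^×|) Σ_{u ∈ R^×} χ(u x))` as complex numbers. -/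
theorem honold_formula (R : Type*) [Ring R] [Fintype R]
    (χ : AddChar R ℂ) (hχ : IsGeneratingCharacter χ)
    (w : R → ℝ) (lam : ℝ) (hw : IsHomogeneousWeight w lam) (x : R) :
    (w x : ℂ) = (lam : ℂ) *
      (1 - (1 / (Nat.card Rˣ : ℂ)) * ∑ᶠ u : Rˣ, χ ((u : R) * x)) := by
  obtain ⟨-, hw₀, hw₁, hw₂⟩ := hw
  rw [← sub_eq_zero]
  refine eq_zero_of_sum_span_eq_zero (f := fun x => (w x : ℂ) - lam *
    (1 - (1 / (Nat.card Rˣ : ℂ)) * ∑ᶠ u : Rˣ, χ ((u : R) * x))) ?_ ?_ ?_ x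
  · classical
    have := Fintype.ofFinite Rˣ
    simp [hw₀, finsum_eq_sum_of_fintype]
  · intro x y h
    simp only [hw₁ x y h, finsum_units_eq_of_span_eq χ h]
  · intro x hx
    have hfin := Set.toFinite ((Ideal.span {x} : Ideal R) : Set R)
    have hweight : ∑ᶠ y ∈ ((Ideal.span {x} : Ideal R) : Set R), (w y : ℂ) =
        lam * (Nat.card (Ideal.span {x} : Ideal R) : ℂ) := by
      have h := congrArg Complex.ofReal (hw₂ x hx)
      rw [finsum_mem_eq_finite_toFinset_sum _ hfin] at h ⊢
      exact_mod_cast h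
    have hchar : ∑ᶠ y ∈ ((Ideal.span {x} : Ideal R) : Set R), ∑ᶠ u : Rˣ, χ (u * y) = 0 := by
      have h := finsum_mem_comm (fun (y : R) (u : Rˣ) => χ (u * y)) hfin Set.finite_univ
      simp only [finsum_mem_univ] at h
      rw [h]
      simp only [hχ.sum_span_eq_zero hx, finsum_zero]
    have hone : ∑ᶠ y ∈ ((Ideal.span {x} : Ideal R) : Set R), (1 : ℂ) =
        (Nat.card (Ideal.span {x} : Ideal R) : ℂ) := by
      rw [finsum_mem_eq_finite_toFinset_sum _ hfin, Finset.sum_const, nsmul_eq_mul, mul_one,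
        ← Set.ncard_eq_toFinset_card _ hfin]
      rfl
    rw [finsum_mem_sub_distrib _ _ hfin, hweight, ← mul_finsum_mem,
      finsum_mem_sub_distrib _ _ hfin, ← mul_finsum_mem, hchar, hone, mul_zero, sub_zero,
      sub_self]
end
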